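/- arXiv:math/0207304 — 2 statements merged into one kernel-verified Lean document; each statement's English description precedes it below -/
import Mathlib

section
/- Let p be a real number with p > 2, let z_1, …, z_m ∈ ℓ^p, and let α_1, …, α_m be nonnegative real numbers such that Σ_{i=1}^m α_i · J(z_i) = 0 (coordinatewise). Then Σ_{i=1}^m Σ_{j=1}^m α_i · α_j · ⟨z_i − z_j, J(z_i) − J(z_j)⟩ ≤ Σ_{i=1}^m Σ_{j=1}^m α_i · α_j · ‖z_i − z_j‖^p. -/
open scoped ENNReal

/-- The coordinatewise duality map on sequences: `(Jmap p x) k = sgn (x k) * |x k| ^ (p - 1)`. -/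
noncomputable def Jmap (p : ℝ) (x : ℕ → ℝ) : ℕ → ℝ :=
  fun k => Real.sign (x k) * |x k| ^ (p - 1)

open MeasureTheory Set

/-- The scalar duality map `t ↦ sgn t * |t| ^ (p - 1)`. -/
noncomputable def signedPow (p t : ℝ) : ℝ := Real.sign t * |t| ^ (p - 1)

lemma signedPow_zero (p : ℝ) : signedPow p 0 = 0 := by simp [signedPow]

lemma signedPow_neg (p t : ℝ) : signedPow p (-t) = -signedPow p t := by
  simp [signedPow, Real.sign_neg]

lemma signedPow_of_nonneg {p t : ℝ} (hp : 1 < p) (ht : 0 ≤ t) :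
    signedPow p t = t ^ (p - 1) := by
  rcases ht.eq_or_lt with rfl | ht
  · rw [signedPow_zero, Real.zero_rpow (by linarith)]
  · rw [signedPow, Real.sign_of_pos ht, abs_of_pos ht, one_mul]

lemma mul_rpow_pred {t q : ℝ} (ht : 0 ≤ t) (hq : 0 < q) : t * t ^ (q - 1) = t ^ q := by
  rcases ht.eq_or_lt with rfl | ht
  · simp [Real.zero_rpow hq.ne']
  · rw [← Real.rpow_one_add' ht.le (by linarith)]; congr 1; ring

lemma abs_signedPow_le (p t : ℝ) : |signedPow p t| ≤ |t| ^ (p - 1) := by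
  have h := Real.rpow_nonneg (abs_nonneg t) (p - 1)
  rcases Real.sign_apply_eq t with hs | hs | hs <;> simp [signedPow, hs, abs_of_nonneg h, h]

lemma mul_signedPow {p : ℝ} (hp : 1 < p) (t : ℝ) : t * signedPow p t = |t| ^ p := by
  rcases le_total 0 t with ht | ht
  · rw [signedPow_of_nonneg hp ht, mul_rpow_pred ht (by linarith), abs_of_nonneg ht]
  · rw [← neg_neg t, signedPow_neg, signedPow_of_nonneg hp (neg_nonneg.2 ht), abs_neg,
      neg_mul_neg, mul_rpow_pred (neg_nonneg.2 ht) (by linarith), abs_of_nonneg (neg_nonneg.2 ht)]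

/-! ### Exponents at least three -/

lemma rpow_add_mul_le_rpow_add {a b u : ℝ} (ha : 0 ≤ a) (hb : 0 < b) (hu : 1 ≤ u) :
    b ^ u + u * a * b ^ (u - 1) ≤ (a + b) ^ u := by
  have h := one_add_mul_self_le_rpow_one_add (s := a / b)
    (by linarith [div_nonneg ha hb.le]) hu
  have h2 : (a + b) ^ u = b ^ u * (1 + a / b) ^ u := by
    rw [← Real.mul_rpow hb.le (by positivity)]; congr 1; field_simp; ring
  have h3 := mul_le_mul_of_nonneg_left h (Real.rpow_nonneg hb.le u)
  have h4 := mul_rpow_pred hb.le (show 0 < u by linarith)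
  rw [h2]
  refine le_trans (le_of_eq ?_) h3
  rw [← h4]; field_simp

lemma rpow_add_rpow_add_mul_le {a b r : ℝ} (ha : 0 < a) (hb : 0 < b) (hr : 2 ≤ r) :
    a ^ r + b ^ r + r * a * b ^ (r - 1) ≤ (a + b) ^ r := by
  have h1 := Real.add_rpow_le_rpow_add ha.le hb.le (show 1 ≤ r - 1 by linarith)
  have h2 := rpow_add_mul_le_rpow_add ha.le hb (show 1 ≤ r - 1 by linarith)
  have e := mul_rpow_pred (add_pos ha hb).le (show 0 < r by linarith)
  have ea := mul_rpow_pred ha.le (show 0 < r by linarith)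
  have eb := mul_rpow_pred hb.le (show 0 < r by linarith)
  have eb' := mul_rpow_pred hb.le (show 0 < r - 1 by linarith)
  have h1' := mul_le_mul_of_nonneg_left h1 ha.le
  have h2' := mul_le_mul_of_nonneg_left h2 hb.le
  have : b * ((r - 1) * a * b ^ (r - 1 - 1)) = (r - 1) * a * b ^ (r - 1) := by
    rw [← eb']; ring
  linarith

lemma rpow_add_rpow_add_mul_add_mul_le {a b p : ℝ} (ha : 0 ≤ a) (hb : 0 ≤ b) (hp : 3 ≤ p) :
    a ^ p + b ^ p + p * (a * b ^ (p - 1) + b * a ^ (p - 1)) ≤ (a + b) ^ p := by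
  have hp0 : p ≠ 0 := by linarith
  have hp1 : p - 1 ≠ 0 := by linarith
  rcases ha.eq_or_lt with rfl | ha
  · simp [Real.zero_rpow hp0, Real.zero_rpow hp1]
  rcases hb.eq_or_lt with rfl | hb
  · simp [Real.zero_rpow hp0, Real.zero_rpow hp1]
  have h1 := rpow_add_rpow_add_mul_le ha hb (show 2 ≤ p - 1 by linarith)
  have h2 := rpow_add_rpow_add_mul_le hb ha (show 2 ≤ p - 1 by linarith)
  rw [add_comm b a] at h2
  have e := mul_rpow_pred (add_pos ha hb).le (show 0 < p by linarith)
  have ea := mul_rpow_pred ha.le (show 0 < p by linarith)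
  have eb := mul_rpow_pred hb.le (show 0 < p by linarith)
  have ea' := mul_rpow_pred ha.le (show 0 < p - 1 by linarith)
  have eb' := mul_rpow_pred hb.le (show 0 < p - 1 by linarith)
  have h1' := mul_le_mul_of_nonneg_left h1 hb.le
  have h2' := mul_le_mul_of_nonneg_left h2 ha.le
  have e1 : b * ((p - 1) * a * b ^ (p - 1 - 1)) = (p - 1) * a * b ^ (p - 1) := by
    rw [← eb']; ring
  have e2 : a * ((p - 1) * b * a ^ (p - 1 - 1)) = (p - 1) * b * a ^ (p - 1) := by
    rw [← ea']; ring
  linarith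

lemma rpow_add_rpow_le_rpow_sub_add {a b p : ℝ} (hb : 0 ≤ b) (hab : b ≤ a) (hp : 1 ≤ p) :
    a ^ p + b ^ p ≤ (a - b) ^ p + p * (a * b ^ (p - 1) + b * a ^ (p - 1)) := by
  rcases (hb.trans hab).eq_or_lt with rfl | ha
  · obtain rfl : b = 0 := le_antisymm hab hb
    simp [Real.zero_rpow (show p ≠ 0 by linarith)]
  have h := one_add_mul_self_le_rpow_one_add (s := -(b / a))
    (by linarith [(div_le_one ha).2 hab]) hp
  have h2 : (a - b) ^ p = a ^ p * (1 + -(b / a)) ^ p := by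
    rw [← Real.mul_rpow ha.le (by linarith [(div_le_one ha).2 hab])]
    congr 1; field_simp; ring
  have h3 := mul_le_mul_of_nonneg_left h (Real.rpow_nonneg ha.le p)
  have ea := mul_rpow_pred ha.le (show 0 < p by linarith)
  have eb := mul_rpow_pred hb (show 0 < p by linarith)
  have h4 : a ^ p * (1 + p * -(b / a)) = a ^ p - p * (b * a ^ (p - 1)) := by
    rw [← ea]; field_simp; ring
  have hb' := Real.rpow_nonneg hb (p - 1)
  have h5 : b ^ p ≤ p * (a * b ^ (p - 1)) := by
    rw [← eb]
    nlinarith [mul_le_mul_of_nonneg_right hab hb', mul_nonneg ha.le hb']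
  linarith

lemma abs_rpow_add_abs_rpow_le {p : ℝ} (hp : 3 ≤ p) (a b : ℝ) :
    |a| ^ p + |b| ^ p ≤ |a - b| ^ p + p * (a * signedPow p b + b * signedPow p a) := by
  have hp1 : 1 < p := by linarith
  have main : ∀ a b : ℝ, 0 ≤ a →
      |a| ^ p + |b| ^ p ≤ |a - b| ^ p + p * (a * signedPow p b + b * signedPow p a) := by
    intro a b ha
    rcases le_total 0 b with hb | hb
    · rw [signedPow_of_nonneg hp1 ha, signedPow_of_nonneg hp1 hb, abs_of_nonneg ha,
        abs_of_nonneg hb]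
      rcases le_total b a with hab | hab
      · rw [abs_of_nonneg (sub_nonneg.2 hab)]
        exact rpow_add_rpow_le_rpow_sub_add hb hab hp1.le
      · rw [abs_sub_comm, abs_of_nonneg (sub_nonneg.2 hab)]
        linarith [rpow_add_rpow_le_rpow_sub_add ha hab hp1.le]
    · obtain ⟨c, rfl⟩ : ∃ c, b = -c := ⟨-b, (neg_neg b).symm⟩
      have hc : 0 ≤ c := by linarith
      rw [signedPow_neg, signedPow_of_nonneg hp1 ha, signedPow_of_nonneg hp1 hc, abs_neg,
        sub_neg_eq_add, abs_of_nonneg ha, abs_of_nonneg hc, abs_of_nonneg (add_nonneg ha hc)]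
      linarith [rpow_add_rpow_add_mul_add_mul_le ha hc hp]
  rcases le_total 0 a with ha | ha
  · exact main a b ha
  · have h := main (-a) (-b) (by linarith)
    rw [signedPow_neg, signedPow_neg, abs_neg, abs_neg, neg_sub_neg, abs_sub_comm b a] at h
    linarith

/-! ### Exponents between two and four -/

lemma integrableOn_Ioi_mul_rpow_neg {f : ℝ → ℝ} (hf : Continuous f) {K m n e : ℝ}
    (h0 : ∀ t, 0 < t → t ≤ 1 → |f t| ≤ K * t ^ m) (h1 : ∀ t, 1 < t → |f t| ≤ K * t ^ n)
    (hm : e < m + 1) (hn : n + 1 < e) :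
    IntegrableOn (fun t => f t * t ^ (-e)) (Ioi 0) := by
  have hc : ContinuousOn (fun t : ℝ => f t * t ^ (-e)) (Ioi 0) :=
    hf.continuousOn.mul fun t ht =>
      (Real.continuousAt_rpow_const t _ (Or.inl (ne_of_gt ht))).continuousWithinAt
  have bound : ∀ q t : ℝ, 0 < t → |f t| ≤ K * t ^ q →
      ‖f t * t ^ (-e)‖ ≤ K * t ^ (q - e) := by
    intro q t ht h
    rw [norm_mul, Real.norm_eq_abs, Real.norm_of_nonneg (Real.rpow_nonneg ht.le _),
      sub_eq_add_neg, Real.rpow_add ht, ← mul_assoc]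
    exact mul_le_mul_of_nonneg_right h (Real.rpow_nonneg ht.le _)
  rw [← Ioc_union_Ioi_eq_Ioi zero_le_one]
  refine IntegrableOn.union ?_ ?_
  · have hi : IntegrableOn (fun t : ℝ => K * t ^ (m - e)) (Ioc 0 1) := by
      have := (intervalIntegral.intervalIntegrable_rpow' (a := 0) (b := 1)
        (show -1 < m - e by linarith)).const_mul K
      rwa [intervalIntegrable_iff_integrableOn_Ioc_of_le zero_le_one] at this
    refine Integrable.mono' hi
      ((hc.mono Ioc_subset_Ioi_self).aestronglyMeasurable measurableSet_Ioc) ?_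
    filter_upwards [ae_restrict_mem measurableSet_Ioc] with t ht
    exact bound m t ht.1 (h0 t ht.1 ht.2)
  · have hi : IntegrableOn (fun t : ℝ => K * t ^ (n - e)) (Ioi 1) :=
      (integrableOn_Ioi_rpow_of_lt (show n - e < -1 by linarith) one_pos).const_mul K
    refine Integrable.mono' hi
      ((hc.mono (Ioi_subset_Ioi zero_le_one)).aestronglyMeasurable measurableSet_Ioi) ?_
    filter_upwards [ae_restrict_mem measurableSet_Ioi] with t ht
    exact bound n t (one_pos.trans ht) (h1 t ht)

lemma eqOn_comp_mul_mul_rpow_neg (f : ℝ → ℝ) {e b : ℝ} (hb : 0 < b) :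
    EqOn (fun t => f (b * t) * t ^ (-e))
      (fun t => b ^ e * (f (b * t) * (b * t) ^ (-e))) (Ioi 0) := by
  intro t ht
  have h : b ^ e * b ^ (-e) = 1 := by rw [← Real.rpow_add hb]; simp
  simp only [Real.mul_rpow hb.le (le_of_lt ht)]
  linear_combination (-(f (b * t) * t ^ (-e))) * h

lemma integrableOn_comp_mul_mul_rpow_neg {f : ℝ → ℝ} {e b : ℝ} (hb : 0 < b)
    (hf : IntegrableOn (fun t => f t * t ^ (-e)) (Ioi 0)) :
    IntegrableOn (fun t => f (b * t) * t ^ (-e)) (Ioi 0) := by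
  rw [integrableOn_congr_fun (eqOn_comp_mul_mul_rpow_neg f hb) measurableSet_Ioi]
  refine Integrable.const_mul ?_ _
  have := (integrableOn_Ioi_comp_mul_left_iff (fun t => f t * t ^ (-e)) 0 hb).2 (by simpa using hf)
  exact this

lemma integral_comp_mul_mul_rpow_neg (f : ℝ → ℝ) {e b : ℝ} (hb : 0 < b) :
    ∫ t in Ioi 0, f (b * t) * t ^ (-e) = b ^ (e - 1) * ∫ t in Ioi 0, f t * t ^ (-e) := by
  rw [setIntegral_congr_fun measurableSet_Ioi (eqOn_comp_mul_mul_rpow_neg f hb),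
    integral_const_mul, integral_comp_mul_left_Ioi (fun t => f t * t ^ (-e)) 0 hb, mul_zero,
    smul_eq_mul, ← mul_assoc, Real.rpow_sub_one hb.ne', div_eq_mul_inv]

/-- The remainder of `cos` after its second order Taylor polynomial. -/
noncomputable def cosRem (t : ℝ) : ℝ := Real.cos t - 1 + t ^ 2 / 2

/-- The remainder of `sin` after its first order Taylor polynomial. -/
noncomputable def sinRem (t : ℝ) : ℝ := Real.sin t - t

lemma cosRem_neg (t : ℝ) : cosRem (-t) = cosRem t := by simp [cosRem]

lemma sinRem_neg (t : ℝ) : sinRem (-t) = -sinRem t := by simp [sinRem]; ring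

lemma cosRem_zero : cosRem 0 = 0 := by simp [cosRem]

lemma sinRem_zero : sinRem 0 = 0 := by simp [sinRem]

lemma cosRem_sub (a b : ℝ) :
    cosRem (a - b) - cosRem a - cosRem b - (a * sinRem b + b * sinRem a) =
      (1 - Real.cos a) * (1 - Real.cos b) + sinRem a * sinRem b := by
  simp only [cosRem, sinRem, Real.cos_sub]; ring

lemma integrableOn_cosRem {p : ℝ} (h2 : 2 < p) (h4 : p < 4) :
    IntegrableOn (fun t => cosRem t * t ^ (-(p + 1))) (Ioi 0) := by
  refine integrableOn_Ioi_mul_rpow_neg (K := 3) (m := 4) (n := 2)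
    (by unfold cosRem; fun_prop) ?_ ?_ (by linarith) (by linarith)
  · intro t ht ht1
    have h := Real.cos_bound (x := t) (by rwa [abs_of_pos ht])
    rw [abs_of_pos ht] at h
    have e : cosRem t = Real.cos t - (1 - t ^ 2 / 2) := by unfold cosRem; ring
    rw [e, show t ^ (4 : ℝ) = t ^ 4 by exact_mod_cast Real.rpow_natCast t 4]
    linarith [pow_pos ht 4]
  · intro t ht
    rw [show t ^ (2 : ℝ) = t ^ 2 by exact_mod_cast Real.rpow_natCast t 2, abs_le]
    unfold cosRem
    constructor <;> nlinarith [Real.neg_one_le_cos t, Real.cos_le_one t]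

lemma integrableOn_sinRem {p : ℝ} (h2 : 2 < p) (h4 : p < 4) :
    IntegrableOn (fun t => sinRem t * t ^ (-p)) (Ioi 0) := by
  refine integrableOn_Ioi_mul_rpow_neg (K := 3) (m := 3) (n := 1)
    (by unfold sinRem; fun_prop) ?_ ?_ (by linarith) (by linarith)
  · intro t ht ht1
    have h := Real.sin_bound (x := t) (by rwa [abs_of_pos ht])
    rw [abs_of_pos ht] at h
    rw [show t ^ (3 : ℝ) = t ^ 3 by exact_mod_cast Real.rpow_natCast t 3]
    have h3 : t ^ 5 ≤ t ^ 3 := pow_le_pow_of_le_one ht.le ht1 (by norm_num)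
    have h0 := pow_pos ht 3
    rw [abs_le] at h ⊢
    unfold sinRem
    constructor <;> linarith [h.1, h.2]
  · intro t ht
    rw [Real.rpow_one, abs_le]
    unfold sinRem
    constructor <;> linarith [Real.neg_one_le_sin t, Real.sin_le_one t]

lemma integral_cosRem_pos {p : ℝ} (h2 : 2 < p) (h4 : p < 4) :
    0 < ∫ t in Ioi 0, cosRem t * t ^ (-(p + 1)) := by
  have hpos : ∀ t ∈ Ioi (0 : ℝ), 0 < cosRem t * t ^ (-(p + 1)) := fun t ht =>
    mul_pos (by unfold cosRem; linarith [Real.one_sub_sq_div_two_lt_cos (ne_of_gt ht)])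
      (Real.rpow_pos_of_pos ht _)
  rw [setIntegral_pos_iff_support_of_nonneg_ae _ (integrableOn_cosRem h2 h4)]
  · have : Function.support (fun t => cosRem t * t ^ (-(p + 1))) ∩ Ioi 0 = Ioi 0 :=
      inter_eq_right.2 fun t ht => (hpos t ht).ne'
    rw [this]; simp
  · filter_upwards [ae_restrict_mem measurableSet_Ioi] with t ht using (hpos t ht).le

lemma integrableOn_cosRem_mul {p : ℝ} (h2 : 2 < p) (h4 : p < 4) (x : ℝ) :
    IntegrableOn (fun t => cosRem (x * t) * t ^ (-(p + 1))) (Ioi 0) := by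
  rcases lt_trichotomy x 0 with hx | rfl | hx
  · have := integrableOn_comp_mul_mul_rpow_neg (neg_pos.2 hx) (integrableOn_cosRem h2 h4)
    simpa only [neg_mul, cosRem_neg] using this
  · simp [cosRem_zero]
  · exact integrableOn_comp_mul_mul_rpow_neg hx (integrableOn_cosRem h2 h4)

lemma integral_cosRem_mul {p : ℝ} (hp : p ≠ 0) (x : ℝ) :
    ∫ t in Ioi 0, cosRem (x * t) * t ^ (-(p + 1)) =
      |x| ^ p * ∫ t in Ioi 0, cosRem t * t ^ (-(p + 1)) := by
  rcases lt_trichotomy x 0 with hx | rfl | hx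
  · have := integral_comp_mul_mul_rpow_neg cosRem (e := p + 1) (neg_pos.2 hx)
    simpa only [neg_mul, cosRem_neg, add_sub_cancel_right, abs_of_neg hx] using this
  · simp [cosRem_zero, Real.zero_rpow hp]
  · rw [integral_comp_mul_mul_rpow_neg cosRem hx, add_sub_cancel_right, abs_of_pos hx]

lemma integrableOn_sinRem_mul {p : ℝ} (h2 : 2 < p) (h4 : p < 4) (x : ℝ) :
    IntegrableOn (fun t => sinRem (x * t) * t ^ (-p)) (Ioi 0) := by
  rcases lt_trichotomy x 0 with hx | rfl | hx
  · have := (integrableOn_comp_mul_mul_rpow_neg (neg_pos.2 hx) (integrableOn_sinRem h2 h4)).neg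
    refine this.congr (Filter.Eventually.of_forall fun t => ?_)
    simp [sinRem_neg]
  · simp [sinRem_zero]
  · exact integrableOn_comp_mul_mul_rpow_neg hx (integrableOn_sinRem h2 h4)

lemma integral_sinRem_mul (p x : ℝ) :
    ∫ t in Ioi 0, sinRem (x * t) * t ^ (-p) =
      signedPow p x * ∫ t in Ioi 0, sinRem t * t ^ (-p) := by
  rcases lt_trichotomy x 0 with hx | rfl | hx
  · have := integral_comp_mul_mul_rpow_neg sinRem (e := p) (neg_pos.2 hx)
    simp only [neg_mul, sinRem_neg, integral_neg] at this
    rw [signedPow, Real.sign_of_neg hx, abs_of_neg hx]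
    linarith
  · simp [sinRem_zero, signedPow_zero]
  · rw [integral_comp_mul_mul_rpow_neg sinRem hx, signedPow, Real.sign_of_pos hx, abs_of_pos hx,
      one_mul]

lemma sum_sum_mul_mul {ι : Type*} [Fintype ι] (α f g : ι → ℝ) :
    ∑ i, ∑ j, α i * α j * (f i * g j) = (∑ i, α i * f i) * ∑ j, α j * g j := by
  rw [Finset.sum_mul_sum]
  exact Finset.sum_congr rfl fun i _ => Finset.sum_congr rfl fun j _ => by ring

lemma exists_sum_kernel_nonneg_of_lt_four {p : ℝ} (h2 : 2 < p) (h4 : p < 4) :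
    ∃ c : ℝ, ∀ {ι : Type} [Fintype ι] (z α : ι → ℝ),
      0 ≤ ∑ i, ∑ j, α i * α j * (|z i - z j| ^ p - |z i| ^ p - |z j| ^ p +
        c * (z i * signedPow p (z j) + z j * signedPow p (z i))) := by
  set C := ∫ t in Ioi 0, cosRem t * t ^ (-(p + 1)) with hC
  set D := ∫ t in Ioi 0, sinRem t * t ^ (-p) with hD
  have hCpos : 0 < C := integral_cosRem_pos h2 h4
  refine ⟨-(D / C), fun {ι} _ z α => ?_⟩
  let k : ℝ → ℝ → ℝ → ℝ := fun a b t =>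
    cosRem ((a - b) * t) * t ^ (-(p + 1)) - cosRem (a * t) * t ^ (-(p + 1))
      - cosRem (b * t) * t ^ (-(p + 1))
      - (a * (sinRem (b * t) * t ^ (-p)) + b * (sinRem (a * t) * t ^ (-p)))
  have ic := integrableOn_cosRem_mul h2 h4
  have is := integrableOn_sinRem_mul h2 h4
  have hk : ∀ a b, IntegrableOn (k a b) (Ioi 0) := fun a b =>
    (((ic _).sub (ic _)).sub (ic _)).sub (((is _).const_mul _).add ((is _).const_mul _))
  have hkint : ∀ a b, ∫ t in Ioi 0, k a b t = C * (|a - b| ^ p - |a| ^ p - |b| ^ p +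
      -(D / C) * (a * signedPow p b + b * signedPow p a)) := by
    intro a b
    have e1 := integral_sub (((ic (a - b)).sub (ic a)).sub (ic b))
      (((is b).const_mul a).add ((is a).const_mul b))
    have e2 := integral_sub ((ic (a - b)).sub (ic a)) (ic b)
    have e3 := integral_sub (ic (a - b)) (ic a)
    have e4 := integral_add ((is b).const_mul a) ((is a).const_mul b)
    simp only [Pi.sub_apply, Pi.add_apply] at e1 e2 e3 e4
    simp only [k]
    rw [e1, e2, e3, e4, integral_const_mul, integral_const_mul]
    simp only [integral_cosRem_mul (show p ≠ 0 by linarith), integral_sinRem_mul, ← hC, ← hD]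
    field_simp
    ring
  have hkeq : ∀ a b t, 0 < t → k a b t =
      ((1 - Real.cos (a * t)) * (1 - Real.cos (b * t)) + sinRem (a * t) * sinRem (b * t)) *
        t ^ (-(p + 1)) := by
    intro a b t ht
    have ht' : t ^ (-p) = t * t ^ (-(p + 1)) := by
      rw [← Real.rpow_one_add' ht.le (by linarith)]; congr 1; ring
    simp only [k]
    rw [← cosRem_sub, ht', sub_mul]
    ring
  refine nonneg_of_mul_nonneg_right (a := C) ?_ hCpos
  have heq : C * ∑ i, ∑ j, α i * α j * (|z i - z j| ^ p - |z i| ^ p - |z j| ^ p +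
        -(D / C) * (z i * signedPow p (z j) + z j * signedPow p (z i))) =
      ∫ t in Ioi 0, ∑ i, ∑ j, α i * α j * k (z i) (z j) t := by
    rw [integral_finsetSum _ fun i _ => integrable_finsetSum _ fun j _ =>
      (hk (z i) (z j)).const_mul _, Finset.mul_sum]
    refine Finset.sum_congr rfl fun i _ => ?_
    rw [integral_finsetSum _ fun j _ => (hk (z i) (z j)).const_mul _, Finset.mul_sum]
    refine Finset.sum_congr rfl fun j _ => ?_
    rw [integral_const_mul, hkint]
    ring
  rw [heq]
  refine setIntegral_nonneg measurableSet_Ioi fun t ht => ?_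
  have hsum : ∑ i, ∑ j, α i * α j * k (z i) (z j) t =
      ((∑ i, α i * (1 - Real.cos (z i * t))) ^ 2 + (∑ i, α i * sinRem (z i * t)) ^ 2) *
        t ^ (-(p + 1)) := by
    rw [sq, sq, ← sum_sum_mul_mul, ← sum_sum_mul_mul, ← Finset.sum_add_distrib, Finset.sum_mul]
    refine Finset.sum_congr rfl fun i _ => ?_
    rw [← Finset.sum_add_distrib, Finset.sum_mul]
    refine Finset.sum_congr rfl fun j _ => ?_
    rw [hkeq _ _ _ ht]; ring
  rw [hsum]
  exact mul_nonneg (by positivity) (Real.rpow_nonneg (le_of_lt ht) _)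

/-! ### The scalar inequality and its sum over the coordinates -/

lemma exists_sum_kernel_nonneg {p : ℝ} (hp : 2 < p) :
    ∃ c : ℝ, ∀ {ι : Type} [Fintype ι] (z α : ι → ℝ), (∀ i, 0 ≤ α i) →
      0 ≤ ∑ i, ∑ j, α i * α j * (|z i - z j| ^ p - |z i| ^ p - |z j| ^ p +
        c * (z i * signedPow p (z j) + z j * signedPow p (z i))) := by
  rcases lt_or_ge p 3 with h3 | h3
  · obtain ⟨c, hc⟩ := exists_sum_kernel_nonneg_of_lt_four hp (by linarith)
    exact ⟨c, fun z α _ => hc z α⟩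
  · exact ⟨p, fun z α hα => Finset.sum_nonneg fun i _ => Finset.sum_nonneg fun j _ =>
      mul_nonneg (mul_nonneg (hα i) (hα j))
        (by linarith [abs_rpow_add_abs_rpow_le h3 (z i) (z j)])⟩

lemma sum_sum_mul_signedPow_le {ι : Type} [Fintype ι] {p : ℝ} (hp : 2 < p) (z α : ι → ℝ)
    (hα : ∀ i, 0 ≤ α i) (hJ : ∑ i, α i * signedPow p (z i) = 0) :
    ∑ i, ∑ j, α i * α j * ((z i - z j) * (signedPow p (z i) - signedPow p (z j))) ≤
      ∑ i, ∑ j, α i * α j * |z i - z j| ^ p := by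
  obtain ⟨c, hc⟩ := exists_sum_kernel_nonneg hp
  have h := hc z α hα
  have h1 : ∑ i, ∑ j, α i * α j * (z i * signedPow p (z j)) = 0 := by
    rw [sum_sum_mul_mul, hJ, mul_zero]
  have h2 : ∑ i, ∑ j, α i * α j * (signedPow p (z i) * z j) = 0 := by
    rw [sum_sum_mul_mul, hJ, zero_mul]
  have key : ∑ i, ∑ j, α i * α j * (|z i - z j| ^ p - |z i| ^ p - |z j| ^ p +
        c * (z i * signedPow p (z j) + z j * signedPow p (z i))) =
      ∑ i, ∑ j, α i * α j * |z i - z j| ^ p -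
      ∑ i, ∑ j, α i * α j * ((z i - z j) * (signedPow p (z i) - signedPow p (z j))) +
      (c - 1) * (∑ i, ∑ j, α i * α j * (z i * signedPow p (z j)) +
        ∑ i, ∑ j, α i * α j * (signedPow p (z i) * z j)) := by
    simp only [Finset.mul_sum, ← Finset.sum_add_distrib, ← Finset.sum_sub_distrib]
    refine Finset.sum_congr rfl fun i _ => Finset.sum_congr rfl fun j _ => ?_
    rw [← mul_signedPow (by linarith) (z i), ← mul_signedPow (by linarith) (z j)]
    ring
  rw [key, h1, h2] at h
  linarith

lemma abs_sub_mul_signedPow_sub_le {p : ℝ} (hp : 1 < p) (a b : ℝ) :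
    |(a - b) * (signedPow p a - signedPow p b)| ≤ 4 * (|a| ^ p + |b| ^ p) := by
  have h1 : |a - b| ≤ 2 * max |a| |b| := by
    linarith [abs_sub a b, le_max_left |a| |b|, le_max_right |a| |b|]
  have hmono : ∀ {t}, |t| ≤ max |a| |b| → |signedPow p t| ≤ max |a| |b| ^ (p - 1) := fun h =>
    (abs_signedPow_le p _).trans (Real.rpow_le_rpow (abs_nonneg _) h (by linarith))
  have h2 : |signedPow p a - signedPow p b| ≤ 2 * max |a| |b| ^ (p - 1) := by
    linarith [abs_sub (signedPow p a) (signedPow p b), hmono (le_max_left |a| |b|),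
      hmono (le_max_right |a| |b|)]
  have h0 : 0 ≤ max |a| |b| := (abs_nonneg a).trans (le_max_left _ _)
  have h3 : max |a| |b| ^ p ≤ |a| ^ p + |b| ^ p := by
    rcases max_choice |a| |b| with h | h <;> rw [h] <;>
      linarith [Real.rpow_nonneg (abs_nonneg a) p, Real.rpow_nonneg (abs_nonneg b) p]
  rw [abs_mul]
  calc _ ≤ (2 * max |a| |b|) * (2 * max |a| |b| ^ (p - 1)) :=
        mul_le_mul h1 h2 (abs_nonneg _) (by positivity)
    _ = 4 * (max |a| |b| * max |a| |b| ^ (p - 1)) := by ring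
    _ = 4 * max |a| |b| ^ p := by rw [mul_rpow_pred h0 (by linarith)]
    _ ≤ _ := by linarith

lemma lp.hasSum_abs_rpow {p : ℝ} (hp : 0 < p) (x : lp (fun _ : ℕ => ℝ) (ENNReal.ofReal p)) :
    HasSum (fun k => |(x : ℕ → ℝ) k| ^ p) (‖x‖ ^ p) := by
  have h := lp.hasSum_norm (p := ENNReal.ofReal p) (by rwa [ENNReal.toReal_ofReal hp.le]) x
  simpa only [ENNReal.toReal_ofReal hp.le, Real.norm_eq_abs] using h

theorem double_sum_pairing_le (p : ℝ) (hp : 2 < p) [Fact (1 ≤ ENNReal.ofReal p)]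
    (m : ℕ) (z : Fin m → lp (fun _ : ℕ => ℝ) (ENNReal.ofReal p))
    (α : Fin m → ℝ) (hα : ∀ i, 0 ≤ α i)
    (hJ : ∀ k, ∑ i, α i * Jmap p (z i : ℕ → ℝ) k = 0) :
    ∑ i, ∑ j, α i * α j *
        (∑' k, ((z i : ℕ → ℝ) k - (z j : ℕ → ℝ) k) *
          (Jmap p (z i : ℕ → ℝ) k - Jmap p (z j : ℕ → ℝ) k)) ≤
      ∑ i, ∑ j, α i * α j * ‖z i - z j‖ ^ p := by
  have hp0 : 0 < p := by linarith
  have hs : ∀ i j, Summable fun k => ((z i : ℕ → ℝ) k - (z j : ℕ → ℝ) k) *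
      (Jmap p (z i : ℕ → ℝ) k - Jmap p (z j : ℕ → ℝ) k) := fun i j =>
    Summable.of_norm_bounded
      (((lp.hasSum_abs_rpow hp0 (z i)).summable.add
        (lp.hasSum_abs_rpow hp0 (z j)).summable).mul_left 4)
      fun k => abs_sub_mul_signedPow_sub_le (by linarith) _ _
  refine hasSum_le
    (fun k => sum_sum_mul_signedPow_le hp (fun i => (z i : ℕ → ℝ) k) α hα (hJ k))
    (hasSum_sum fun i _ => hasSum_sum fun j _ => (hs i j).hasSum.mul_left _)
    (hasSum_sum fun i _ => hasSum_sum fun j _ => HasSum.mul_left _ ?_)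
  simpa only [lp.coeFn_sub, Pi.sub_apply] using lp.hasSum_abs_rpow hp0 (z i - z j)
end

section
/- Let p be a real number with 1 < p ≤ 2 and let A be a finite nonempty subset of ℓ^p with Chebyshev radius r := r(A) > 0. Then there exist points y_1, …, y_m ∈ A and positive real numbers α_1, …, α_m with Σ_{i=1}^m α_i = 1 such that 2·r^p ≤ 2^(2−p) · Σ_{i=1}^m Σ_{j=1}^m α_i · α_j · ‖y_i − y_j‖^p. -/
open scoped ENNReal

noncomputable def chebRadius {p : ℝ≥0∞} [Fact (1 ≤ p)]
    (A : Set (lp (fun _ : ℕ => ℝ) p)) : ℝ :=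
  ⨅ y : lp (fun _ : ℕ => ℝ) p, ⨆ x : A, ‖(x : lp (fun _ : ℕ => ℝ) p) - y‖

/-- The odd extension of `t ↦ t ^ q` from the nonnegative reals to all reals. -/
noncomputable def signedRpow (q t : ℝ) : ℝ := max t 0 ^ q - max (-t) 0 ^ q

lemma signedRpow_of_nonneg {q t : ℝ} (hq : 0 < q) (ht : 0 ≤ t) : signedRpow q t = t ^ q := by
  rw [signedRpow, max_eq_left ht, max_eq_right (by linarith), Real.zero_rpow hq.ne', sub_zero]

lemma signedRpow_neg (q t : ℝ) : signedRpow q (-t) = -signedRpow q t := by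
  simp [signedRpow]

lemma continuous_signedRpow {q : ℝ} (hq : 0 < q) : Continuous (signedRpow q) := by
  unfold signedRpow
  exact ((continuous_id.max continuous_const).rpow_const fun _ => Or.inr hq.le).sub
    ((continuous_neg.max continuous_const).rpow_const fun _ => Or.inr hq.le)

lemma signedRpow_mul_self {q : ℝ} (hq : 0 < q) (t : ℝ) :
    signedRpow q t * t = |t| ^ (q + 1) := by
  have key : ∀ s : ℝ, 0 ≤ s → signedRpow q s * s = |s| ^ (q + 1) := fun s hs => by
    rw [signedRpow_of_nonneg hq hs, abs_of_nonneg hs, Real.rpow_add_one' hs (by linarith)]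
  rcases le_total 0 t with ht | ht
  · exact key t ht
  · have h := key (-t) (by linarith)
    rwa [signedRpow_neg, abs_neg, neg_mul_neg] at h

lemma rpow_add_rpow_le_two_rpow_mul {q a b : ℝ} (hq : 0 < q) (hq1 : q ≤ 1)
    (ha : 0 ≤ a) (hb : 0 ≤ b) : a ^ q + b ^ q ≤ 2 ^ (1 - q) * (a + b) ^ q := by
  have h := (Real.concaveOn_rpow hq.le hq1).2 (Set.mem_Ici.2 ha) (Set.mem_Ici.2 hb)
    (by norm_num : (0 : ℝ) ≤ 1 / 2) (by norm_num : (0 : ℝ) ≤ 1 / 2) (by norm_num)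
  simp only [smul_eq_mul] at h
  rw [← mul_add, ← mul_add, Real.mul_rpow (by norm_num) (by linarith), one_div,
    Real.inv_rpow (by norm_num)] at h
  rw [Real.rpow_sub two_pos, Real.rpow_one, div_eq_mul_inv]
  linarith

lemma signedRpow_sub_le {q a b : ℝ} (hq : 0 < q) (hq1 : q ≤ 1) (hab : b ≤ a) :
    signedRpow q a - signedRpow q b ≤ 2 ^ (1 - q) * (a - b) ^ q := by
  have key : ∀ s t : ℝ, 0 ≤ t → t ≤ s →
      signedRpow q s - signedRpow q t ≤ 2 ^ (1 - q) * (s - t) ^ q := fun s t ht hts => by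
    rw [signedRpow_of_nonneg hq (ht.trans hts), signedRpow_of_nonneg hq ht]
    have h := Real.rpow_add_le_add_rpow (sub_nonneg.2 hts) ht hq.le hq1
    rw [sub_add_cancel] at h
    have h1 : (1 : ℝ) ≤ 2 ^ (1 - q) := Real.one_le_rpow one_le_two (by linarith)
    have h2 : 0 ≤ (s - t) ^ q := Real.rpow_nonneg (by linarith) _
    nlinarith
  rcases le_total 0 b with hb | hb
  · exact key a b hb hab
  rcases le_total 0 a with ha | ha
  · have h := rpow_add_rpow_le_two_rpow_mul hq hq1 ha (neg_nonneg.2 hb)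
    rw [← signedRpow_of_nonneg hq ha, ← signedRpow_of_nonneg hq (neg_nonneg.2 hb),
      signedRpow_neg] at h
    simpa only [sub_eq_add_neg] using h
  · have h := key (-b) (-a) (by linarith) (by linarith)
    rw [signedRpow_neg, signedRpow_neg] at h
    rw [show a - b = -b - -a by ring]
    linarith

lemma signedRpow_sub_mul_sub_le {q : ℝ} (hq : 0 < q) (hq1 : q ≤ 1) (a b : ℝ) :
    (signedRpow q a - signedRpow q b) * (a - b) ≤ 2 ^ (1 - q) * |a - b| ^ (q + 1) := by
  have key : ∀ s t : ℝ, t ≤ s →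
      (signedRpow q s - signedRpow q t) * (s - t) ≤ 2 ^ (1 - q) * |s - t| ^ (q + 1) :=
    fun s t hts => by
      have hst : 0 ≤ s - t := sub_nonneg.2 hts
      rw [abs_of_nonneg hst, Real.rpow_add_one' hst (by linarith), ← mul_assoc]
      exact mul_le_mul_of_nonneg_right (signedRpow_sub_le hq hq1 hts) hst
  rcases le_total b a with h | h
  · exact key a b h
  · have := key b a h
    rw [abs_sub_comm a b]
    linarith

/-- A weighted family of reals has a point balancing the weighted sum of signed powers. -/
lemma exists_sum_mul_signedRpow_eq_zero {ι : Type*} [Fintype ι] {q : ℝ} (hq : 0 < q)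
    {α : ι → ℝ} (hα : ∀ i, 0 ≤ α i) (x : ι → ℝ) :
    ∃ c : ℝ, |c| ≤ ∑ i, |x i| ∧ ∑ i, α i * signedRpow q (x i - c) = 0 := by
  set M := ∑ i, |x i|
  have hM0 : 0 ≤ M := Finset.sum_nonneg fun i _ => abs_nonneg _
  have hx : ∀ i, |x i| ≤ M := fun i =>
    Finset.single_le_sum (f := fun i => |x i|) (fun i _ => abs_nonneg _) (Finset.mem_univ i)
  have hcont : Continuous fun c => ∑ i, α i * signedRpow q (x i - c) :=
    continuous_finsetSum _ fun i _ => continuous_const.mul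
      ((continuous_signedRpow hq).comp (continuous_const.sub continuous_id))
  have h0 : (0 : ℝ) ∈ Set.Icc (∑ i, α i * signedRpow q (x i - M))
      (∑ i, α i * signedRpow q (x i - -M)) := by
    constructor
    · refine Finset.sum_nonpos fun i _ => mul_nonpos_of_nonneg_of_nonpos (hα i) ?_
      have hi : 0 ≤ M - x i := sub_nonneg.2 ((le_abs_self _).trans (hx i))
      rw [← neg_sub, signedRpow_neg, signedRpow_of_nonneg hq hi]
      exact neg_nonpos.2 (Real.rpow_nonneg hi _)
    · refine Finset.sum_nonneg fun i _ => mul_nonneg (hα i) ?_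
      have hi : 0 ≤ x i - -M := by linarith [neg_abs_le (x i), hx i]
      rw [signedRpow_of_nonneg hq hi]
      exact Real.rpow_nonneg hi _
  obtain ⟨c, hc, hc0⟩ := intermediate_value_Icc' (by linarith : -M ≤ M) hcont.continuousOn h0
  exact ⟨c, abs_le.2 hc, hc0⟩

lemma two_mul_sum_rpow_le_of_balanced {ι : Type*} [Fintype ι] {q : ℝ} (hq : 0 < q) (hq1 : q ≤ 1)
    {α : ι → ℝ} (hα : ∀ i, 0 ≤ α i) (hsum : ∑ i, α i = 1) (a : ι → ℝ)
    (ha : ∑ i, α i * signedRpow q (a i) = 0) :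
    2 * ∑ i, α i * |a i| ^ (q + 1) ≤
      2 ^ (1 - q) * ∑ i, ∑ j, α i * α j * |a i - a j| ^ (q + 1) := by
  have hexp : ∑ i, ∑ j, α i * α j * ((signedRpow q (a i) - signedRpow q (a j)) * (a i - a j)) =
      2 * ∑ i, α i * |a i| ^ (q + 1) := by
    have : ∀ i j, α i * α j * ((signedRpow q (a i) - signedRpow q (a j)) * (a i - a j)) =
        (α i * |a i| ^ (q + 1)) * α j + α i * (α j * |a j| ^ (q + 1))
          - (α i * signedRpow q (a i)) * (α j * a j)
          - (α i * a i) * (α j * signedRpow q (a j)) := fun i j => by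
      rw [← signedRpow_mul_self hq, ← signedRpow_mul_self hq]; ring
    simp only [this, Finset.sum_sub_distrib, Finset.sum_add_distrib, ← Finset.sum_mul_sum, ha,
      hsum]
    ring
  rw [← hexp, Finset.mul_sum]
  refine Finset.sum_le_sum fun i _ => ?_
  rw [Finset.mul_sum]
  refine Finset.sum_le_sum fun j _ => ?_
  rw [mul_left_comm (2 ^ (1 - q))]
  exact mul_le_mul_of_nonneg_left (signedRpow_sub_mul_sub_le hq hq1 _ _)
    (mul_nonneg (hα i) (hα j))

lemma lp_hasSum_abs_rpow {p : ℝ} (hp : 0 < p) (f : lp (fun _ : ℕ => ℝ) (ENNReal.ofReal p)) :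
    HasSum (fun k => |f k| ^ p) (‖f‖ ^ p) := by
  have hp' : (ENNReal.ofReal p).toReal = p := ENNReal.toReal_ofReal hp.le
  simpa [hp'] using lp.hasSum_norm (by rw [hp']; exact hp) f

/-- For nonnegative weights of total mass one, some point `c` has weighted `p`-th power distance
to a family controlled by the weighted `p`-th powers of the mutual distances. -/
lemma exists_two_mul_sum_norm_rpow_le {ι : Type*} [Fintype ι] {p : ℝ} (hp1 : 1 < p) (hp2 : p ≤ 2)
    [Fact (1 ≤ ENNReal.ofReal p)] {α : ι → ℝ} (hα : ∀ i, 0 ≤ α i) (hsum : ∑ i, α i = 1)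
    (x : ι → lp (fun _ : ℕ => ℝ) (ENNReal.ofReal p)) :
    ∃ c : lp (fun _ : ℕ => ℝ) (ENNReal.ofReal p),
      2 * ∑ i, α i * ‖x i - c‖ ^ p ≤
        2 ^ (2 - p) * ∑ i, ∑ j, α i * α j * ‖x i - x j‖ ^ p := by
  have hp : 0 < p := by linarith
  have hq : 0 < p - 1 := by linarith
  choose c hcle hc using fun k : ℕ =>
    exists_sum_mul_signedRpow_eq_zero hq hα fun i => x i k
  have hmem : Memℓp (fun k => ∑ i, |x i k|) (ENNReal.ofReal p) :=
    Memℓp.finsetSum Finset.univ fun i _ => by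
      refine (lp.memℓp (x i)).mono' fun k => ?_
      simp
  have hcmem : Memℓp c (ENNReal.ofReal p) := by
    refine hmem.mono' fun k => ?_
    exact (hcle k).trans (le_abs_self _)
  refine ⟨⟨c, hcmem⟩, ?_⟩
  refine hasSum_le (fun k => ?_)
    ((hasSum_sum fun i _ => (lp_hasSum_abs_rpow hp (x i - ⟨c, hcmem⟩)).mul_left (α i)).mul_left 2)
    ((hasSum_sum fun i _ => hasSum_sum fun j _ =>
      (lp_hasSum_abs_rpow hp (x i - x j)).mul_left (α i * α j)).mul_left (2 ^ (2 - p)))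
  have h := two_mul_sum_rpow_le_of_balanced hq (by linarith) hα hsum (fun i => x i k - c k) (hc k)
  rw [sub_add_cancel, show 1 - (p - 1) = 2 - p by ring] at h
  simp only [sub_sub_sub_cancel_right] at h
  exact h

/-- Minimax bound: if every point is at distance at least `r` from some member of a finite family,
then suitable weights make the weighted `p`-th power distance at least `r ^ p` everywhere. -/
lemma exists_weights_rpow_le_sum {ι E : Type*} [Fintype ι] [SeminormedAddCommGroup E]
    [NormedSpace ℝ E] {p r : ℝ} (hp : 1 ≤ p) (hr : 0 ≤ r) (x : ι → E)
    (hx : ∀ y, ∃ i, r ≤ ‖x i - y‖) :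
    ∃ α : ι → ℝ, (∀ i, 0 ≤ α i) ∧ ∑ i, α i = 1 ∧
      ∀ y, r ^ p ≤ ∑ i, α i * ‖x i - y‖ ^ p := by
  classical
  set U : Set (ι → ℝ) := Set.univ.pi fun _ => Set.Iio (r ^ p)
  set C : Set (ι → ℝ) := {v | ∃ y, ∀ i, ‖x i - y‖ ^ p ≤ v i}
  have hUconv : Convex ℝ U := convex_pi fun _ _ => convex_Iio _
  have hUopen : IsOpen U := isOpen_set_pi Set.finite_univ fun _ _ => isOpen_Iio
  have hCconv : Convex ℝ C := by
    rintro v ⟨y, hy⟩ w ⟨z, hz⟩ a b ha hb hab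
    refine ⟨a • y + b • z, fun i => ?_⟩
    have hle : ‖x i - (a • y + b • z)‖ ≤ a * ‖x i - y‖ + b * ‖x i - z‖ := by
      have : x i - (a • y + b • z) = a • (x i - y) + b • (x i - z) := by
        rw [smul_sub, smul_sub, ← add_sub_add_comm, ← add_smul, hab, one_smul]
      rw [this]
      refine (norm_add_le _ _).trans ?_
      rw [norm_smul, norm_smul, Real.norm_of_nonneg ha, Real.norm_of_nonneg hb]
    calc ‖x i - (a • y + b • z)‖ ^ p ≤ (a * ‖x i - y‖ + b * ‖x i - z‖) ^ p :=
          Real.rpow_le_rpow (norm_nonneg _) hle (by linarith)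
      _ ≤ a * ‖x i - y‖ ^ p + b * ‖x i - z‖ ^ p :=
          (convexOn_rpow hp).2 (Set.mem_Ici.2 (norm_nonneg _)) (Set.mem_Ici.2 (norm_nonneg _))
            ha hb hab
      _ ≤ a * v i + b * w i :=
          add_le_add (mul_le_mul_of_nonneg_left (hy i) ha) (mul_le_mul_of_nonneg_left (hz i) hb)
  have hdisj : Disjoint U C := by
    rw [Set.disjoint_left]
    rintro v hv ⟨y, hy⟩
    obtain ⟨i, hi⟩ := hx y
    have h1 : v i < r ^ p := hv i (Set.mem_univ i)
    have h2 : r ^ p ≤ ‖x i - y‖ ^ p := Real.rpow_le_rpow hr hi (by linarith)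
    linarith [hy i]
  obtain ⟨f, s, hfU, hfC⟩ := geometric_hahn_banach_open hUconv hUopen hCconv hdisj
  set β : ι → ℝ := fun i => f (Pi.single i 1) with hβ
  have hf : ∀ v, f v = ∑ i, v i * β i := fun v => by
    conv_lhs => rw [pi_eq_sum_univ' v, map_sum]
    refine Finset.sum_congr rfl fun i _ => ?_
    rw [map_smul, smul_eq_mul, hβ]
  have hβ0 : ∀ i, 0 ≤ β i := fun i => by
    by_contra! hi
    set v : ι → ℝ := fun j => ‖x j - 0‖ ^ p
    obtain ⟨t, ht0, ht⟩ : ∃ t : ℝ, 0 ≤ t ∧ f v + t * β i < s := by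
      refine ⟨(|s - f v| + 1) / (-β i), div_nonneg (by positivity) (by linarith), ?_⟩
      have : (|s - f v| + 1) / (-β i) * β i = -(|s - f v| + 1) := by
        rw [div_neg, neg_mul, div_mul_cancel₀ _ hi.ne]
      rw [this]
      linarith [neg_abs_le (s - f v)]
    have hmem : v + t • Pi.single i 1 ∈ C := by
      refine ⟨0, fun j => ?_⟩
      have : 0 ≤ (t • Pi.single i (1 : ℝ) : ι → ℝ) j := by
        by_cases h : j = i
        · subst h; simpa using ht0
        · simp [h]
      simpa [v] using this
    have h := hfC _ hmem
    rw [map_add, map_smul, smul_eq_mul] at h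
    linarith
  have hle : ∀ y, r ^ p * ∑ i, β i ≤ ∑ i, ‖x i - y‖ ^ p * β i := fun y => by
    rw [← hf]
    refine le_trans ?_ (hfC _ ⟨y, fun i => le_rfl⟩)
    refine le_of_forall_pos_le_add fun ε hε => ?_
    set B := ∑ i, β i with hB
    have hB0 : 0 ≤ B := Finset.sum_nonneg fun i _ => hβ0 i
    have h := hfU (fun _ => r ^ p - ε / (B + 1)) fun i _ =>
      sub_lt_self _ (div_pos hε (by linarith))
    rw [hf, ← Finset.mul_sum, ← hB, sub_mul] at h
    have : ε / (B + 1) * B ≤ ε := by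
      rw [div_mul_eq_mul_div, div_le_iff₀ (by linarith)]
      nlinarith
    linarith
  have hpos : 0 < ∑ i, β i := by
    refine (Finset.sum_nonneg fun i _ => hβ0 i).lt_of_ne fun h => ?_
    have hz : ∀ i, β i = 0 := fun i =>
      (Finset.sum_eq_zero_iff_of_nonneg fun i _ => hβ0 i).1 h.symm i (Finset.mem_univ i)
    have h1 := hfU (fun _ => r ^ p - 1) fun i _ => sub_one_lt (r ^ p)
    have h2 := hfC _ ⟨0, fun i => le_rfl⟩
    rw [hf] at h1 h2
    simp only [hz, mul_zero, Finset.sum_const_zero] at h1 h2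
    linarith
  refine ⟨fun i => β i / ∑ j, β j, fun i => div_nonneg (hβ0 i) hpos.le, ?_, fun y => ?_⟩
  · rw [← Finset.sum_div, div_self hpos.ne']
  · have : ∑ i, β i / (∑ j, β j) * ‖x i - y‖ ^ p =
        (∑ i, ‖x i - y‖ ^ p * β i) / ∑ j, β j := by
      rw [Finset.sum_div]
      exact Finset.sum_congr rfl fun i _ => by ring
    rw [this, le_div_iff₀ hpos]
    exact hle y

lemma exists_chebRadius_le_norm_sub {p : ℝ≥0∞} [Fact (1 ≤ p)]
    {A : Set (lp (fun _ : ℕ => ℝ) p)} (hfin : A.Finite) (hne : A.Nonempty)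
    (y : lp (fun _ : ℕ => ℝ) p) :
    ∃ x : A, chebRadius A ≤ ‖(x : lp (fun _ : ℕ => ℝ) p) - y‖ := by
  have := hfin.to_subtype
  have := hne.to_subtype
  obtain ⟨x, hx⟩ := exists_eq_ciSup_of_finite
    (f := fun x : A => ‖(x : lp (fun _ : ℕ => ℝ) p) - y‖)
  refine ⟨x, hx ▸ ciInf_le ⟨0, ?_⟩ y⟩
  rintro _ ⟨z, rfl⟩
  exact Real.iSup_nonneg fun _ => norm_nonneg _

theorem radius_le_double_sum_small_p (p : ℝ) (hp1 : 1 < p) (hp2 : p ≤ 2)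
    [Fact (1 ≤ ENNReal.ofReal p)]
    (A : Set (lp (fun _ : ℕ => ℝ) (ENNReal.ofReal p)))
    (hfin : A.Finite) (hne : A.Nonempty) (hr : 0 < chebRadius A) :
    ∃ (m : ℕ) (y : Fin m → lp (fun _ : ℕ => ℝ) (ENNReal.ofReal p)) (α : Fin m → ℝ),
      (∀ i, y i ∈ A) ∧ (∀ i, 0 < α i) ∧ (∑ i, α i = 1) ∧
      2 * chebRadius A ^ p ≤ 2 ^ (2 - p) * ∑ i, ∑ j, α i * α j * ‖y i - y j‖ ^ p := by
  classical
  have := hfin.fintype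
  obtain ⟨α, hα0, hα1, hα⟩ := exists_weights_rpow_le_sum hp1.le hr.le
    (fun x : A => (x : lp (fun _ : ℕ => ℝ) (ENNReal.ofReal p)))
    (exists_chebRadius_le_norm_sub hfin hne)
  let e := (Fintype.equivFin {x : A // 0 < α x}).symm
  have hsupp : ∀ g : A → ℝ, (∀ x, α x = 0 → g x = 0) → ∑ i, g (e i) = ∑ x, g x := fun g hg => by
    rw [e.sum_comp fun x => g x, ← Fintype.sum_subtype_add_sum_subtype (fun x => 0 < α x) g,
      left_eq_add]
    exact Finset.sum_eq_zero fun x _ => hg x (le_antisymm (not_lt.1 x.2) (hα0 x))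
  have hsum : ∑ i, α (e i) = 1 := by rw [hsupp α fun _ h => h, hα1]
  refine ⟨_, fun i => ((e i : A) : lp (fun _ : ℕ => ℝ) (ENNReal.ofReal p)), fun i => α (e i),
    fun i => (e i : A).2, fun i => (e i).2, hsum, ?_⟩
  obtain ⟨c, hc⟩ := exists_two_mul_sum_norm_rpow_le hp1 hp2 (fun i => (e i).2.le) hsum
    fun i => ((e i : A) : lp (fun _ : ℕ => ℝ) (ENNReal.ofReal p))
  refine le_trans ?_ hc
  rw [hsupp (fun x => α x * ‖(x : lp (fun _ : ℕ => ℝ) (ENNReal.ofReal p)) - c‖ ^ p)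
    fun x hx => by rw [hx, zero_mul]]
  exact mul_le_mul_of_nonneg_left (hα c) zero_le_two
end
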